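/- arXiv:1606.08413 — 5 statements merged into one kernel-verified Lean document; each statement's English description precedes it below -/
import Mathlib

section
/- Let T be a tensor triangulated category whose unit object 1 is compact and which is compactly generated by the single object 1 (i.e., every object x with Hom(1[n], x) = 0 for all n ∈ ℤ is zero). Then every thick subcategory of T^c is a tensor ideal of T^c: if C ⊆ T^c is thick, c ∈ C, and t ∈ T^c, then t ⊗ c ∈ C. -/
open CategoryTheory Category Limits Pretriangulated ZeroObject MonoidalCategory

universe v u u₂

namespace Paper

variable {C : Type u} [Category.{v} C] [Preadditive C] [HasZeroObject C] [HasShift C ℤ]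
  [∀ n : ℤ, (shiftFunctor C n).Additive] [Pretriangulated C] [IsTriangulated C]
  [HasCoproducts.{v} C]

variable [MonoidalCategory C] [SymmetricCategory C]
  [∀ X : C, (tensorLeft X).CommShift ℤ]
  [∀ X : C, (tensorRight X).CommShift ℤ]
  [∀ X : C, (tensorLeft X).IsTriangulated]
  [∀ X : C, (tensorRight X).IsTriangulated]
  [∀ (X : C) (ι : Type v), PreservesColimitsOfShape (Discrete ι) (tensorLeft X)]
  [∀ (X : C) (ι : Type v), PreservesColimitsOfShape (Discrete ι) (tensorRight X)]

/-- A (full, replete) triangulated subcategory, encoded as its set of objects: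
it contains a zero object, is closed under isomorphisms, and satisfies two-out-of-three
for distinguished triangles. -/
structure IsTriangulatedSub {E : Type*} [Category E] [Preadditive E] [HasZeroObject E]
    [HasShift E ℤ] [∀ n : ℤ, (shiftFunctor E n).Additive] [Pretriangulated E]
    (S : Set E) : Prop where
  zero_mem : (0 : E) ∈ S
  iso_closed : ∀ ⦃X Y : E⦄, (X ≅ Y) → X ∈ S → Y ∈ S
  two_of_three₃ : ∀ T, (T ∈ distTriang E) → T.obj₁ ∈ S → T.obj₂ ∈ S → T.obj₃ ∈ S
  two_of_three₂ : ∀ T, (T ∈ distTriang E) → T.obj₁ ∈ S → T.obj₃ ∈ S → T.obj₂ ∈ S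
  two_of_three₁ : ∀ T, (T ∈ distTriang E) → T.obj₂ ∈ S → T.obj₃ ∈ S → T.obj₁ ∈ S

/-- A localizing subcategory: a triangulated subcategory closed under small coproducts. -/
def IsLocalizing (S : Set C) : Prop :=
  IsTriangulatedSub S ∧ ∀ {ι : Type v} (x : ι → C), (∀ i, x i ∈ S) → (∐ x) ∈ S

/-- `⟨A⟩`: the smallest localizing subcategory containing the class `A`. -/
def localizingGen (A : Set C) : Set C :=
  ⋂₀ {S : Set C | IsLocalizing S ∧ A ⊆ S}

/-- The canonical comparison map `⊕ᵢ Hom(t, x i) →+ Hom(t, ∐ x)` sending the `i`-th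
component `g` to `g ≫ Sigma.ι x i`. -/
noncomputable def coproductComparison (t : C) {ι : Type v} (x : ι → C) :
    (DirectSum ι fun i => (t ⟶ x i)) →+ (t ⟶ ∐ x) :=
  letI : DecidableEq ι := Classical.decEq ι
  DirectSum.toAddMonoid fun i =>
    AddMonoidHom.mk' (fun g => g ≫ Sigma.ι x i) fun _ _ => Preadditive.add_comp _ _ _ _ _ _

/-- An object `t` is compact if for every small family `x` the canonical map
`⊕ᵢ Hom(t, x i) → Hom(t, ∐ x)` is bijective. -/
def IsCompactObj (t : C) : Prop :=
  ∀ {ι : Type v} (x : ι → C), Function.Bijective (coproductComparison t x)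

variable (C) in
/-- The class `T^c` of compact objects. -/
def compacts : Set C := {t : C | IsCompactObj t}

variable (C) in
/-- `T` is compactly generated: there is a set of compact objects `G` such that any object
receiving no nonzero maps from shifts of objects of `G` is zero. -/
def IsCompactlyGenerated : Prop :=
  ∃ G : Set C, (∀ g ∈ G, IsCompactObj g) ∧
    ∀ x : C, (∀ g ∈ G, ∀ n : ℤ, ∀ f : (g⟦n⟧ ⟶ x), f = 0) → IsZero x

/-- A thick subcategory: a triangulated subcategory closed under direct summands. -/
def IsThick (S : Set C) : Prop :=
  IsTriangulatedSub S ∧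
    ∀ ⦃X Y : C⦄, (∃ (i : Y ⟶ X) (r : X ⟶ Y), i ≫ r = 𝟙 Y) → X ∈ S → Y ∈ S

/-- The morphism `f` factors through an object satisfying `P`. -/
def FactorsVia {D : Type*} [Category* D] (P : ObjectProperty D) {X Y : D} (f : X ⟶ Y) : Prop :=
  ∃ (Z : D) (a : X ⟶ Z) (b : Z ⟶ Y), P Z ∧ a ≫ b = f

section Sigma

variable {D : Type u} [Category.{v} D] [Preadditive D] [HasCoproducts.{v} D]

open Classical in
/-- The projection of a coproduct onto one of its summands. -/
noncomputable def sigmaπ {ι : Type v} (x : ι → D) (i : ι) : ∐ x ⟶ x i := Sigma.π x i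

lemma ι_sigmaπ_self {ι : Type v} (x : ι → D) (i : ι) : Sigma.ι x i ≫ sigmaπ x i = 𝟙 _ := by
  classical exact Sigma.ι_π_eq_id x i

lemma ι_sigmaπ_self_assoc {ι : Type v} (x : ι → D) (i : ι) {Z : D} (h : x i ⟶ Z) :
    Sigma.ι x i ≫ sigmaπ x i ≫ h = h := by
  rw [← Category.assoc, ι_sigmaπ_self, Category.id_comp]

lemma ι_sigmaπ_of_ne {ι : Type v} (x : ι → D) {i j : ι} (h : i ≠ j) :
    Sigma.ι x i ≫ sigmaπ x j = 0 := by
  classical exact Sigma.ι_π_of_ne x h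

lemma ι_sigmaπ_of_ne_assoc {ι : Type v} (x : ι → D) {i j : ι} (h : i ≠ j) {Z : D}
    (f : x j ⟶ Z) : Sigma.ι x i ≫ sigmaπ x j ≫ f = 0 := by
  rw [← Category.assoc, ι_sigmaπ_of_ne x h, zero_comp]

/-- The idempotent of `∐ x` projecting onto the summands indexed by the finite set `J`. -/
noncomputable def sigmaProj {ι : Type v} (x : ι → D) (J : Finset ι) : ∐ x ⟶ ∐ x :=
  ∑ i ∈ J, sigmaπ x i ≫ Sigma.ι x i

lemma ι_sigmaProj_of_mem {ι : Type v} (x : ι → D) {J : Finset ι} {j : ι} (hj : j ∈ J) :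
    Sigma.ι x j ≫ sigmaProj x J = Sigma.ι x j := by
  rw [sigmaProj, Preadditive.comp_sum, Finset.sum_eq_single_of_mem j hj]
  · rw [ι_sigmaπ_self_assoc]
  · intro b _ hb
    rw [ι_sigmaπ_of_ne_assoc _ hb.symm]

lemma sigmaProj_π_of_notMem {ι : Type v} (x : ι → D) {J : Finset ι} {j : ι} (hj : j ∉ J) :
    sigmaProj x J ≫ sigmaπ x j = 0 := by
  rw [sigmaProj, Preadditive.sum_comp]
  refine Finset.sum_eq_zero fun i hi => ?_
  rw [Category.assoc, ι_sigmaπ_of_ne _ (by rintro rfl; exact hj hi), comp_zero]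

lemma sigmaProj_comp_of_subset {ι : Type v} (x : ι → D) {J K : Finset ι} (h : J ⊆ K) :
    sigmaProj x J ≫ sigmaProj x K = sigmaProj x J := by
  nth_rw 1 [sigmaProj]
  rw [Preadditive.sum_comp]
  refine Finset.sum_congr rfl fun i hi => ?_
  rw [Category.assoc, ι_sigmaProj_of_mem x (h hi)]

lemma sum_comp_sigmaProj {ι : Type v} (x : ι → D) {t : D} (J : Finset ι) (g : ∀ i, t ⟶ x i) :
    (∑ i ∈ J, g i ≫ Sigma.ι x i) ≫ sigmaProj x J = ∑ i ∈ J, g i ≫ Sigma.ι x i := by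
  rw [Preadditive.sum_comp]
  refine Finset.sum_congr rfl fun i hi => ?_
  rw [Category.assoc, ι_sigmaProj_of_mem x hi]

lemma coproductComparison_of (t : D) {ι : Type v} [DecidableEq ι] (x : ι → D) (i : ι)
    (g : t ⟶ x i) :
    coproductComparison t x (DirectSum.of (fun i => (t ⟶ x i)) i g) = g ≫ Sigma.ι x i := by
  classical
  have h : (‹DecidableEq ι› : DecidableEq ι) = Classical.decEq ι := Subsingleton.elim _ _
  subst h
  simp [coproductComparison]

lemma coproductComparison_π (t : D) {ι : Type v} (x : ι → D)
    (y : DirectSum ι fun i => (t ⟶ x i)) (i : ι) :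
    coproductComparison t x y ≫ sigmaπ x i = y i := by
  classical
  induction y using DirectSum.induction_on with
  | zero => simp
  | of j g =>
    rw [coproductComparison_of, Category.assoc]
    by_cases h : j = i
    · subst h
      rw [ι_sigmaπ_self, Category.comp_id, DirectSum.of_eq_same]
    · rw [ι_sigmaπ_of_ne _ h, comp_zero, DirectSum.of_eq_of_ne _ _ _ (Ne.symm h)]
  | add y z hy hz => rw [map_add, Preadditive.add_comp, hy, hz, DirectSum.add_apply]

/-- An object is compact if and only if every morphism to a coproduct is concentrated on finitely
many summands. -/
lemma isCompactObj_iff (t : D) : IsCompactObj t ↔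
    ∀ {ι : Type v} (x : ι → D) (f : t ⟶ ∐ x), ∃ J : Finset ι, f ≫ sigmaProj x J = f := by
  classical
  constructor
  · intro h ι x f
    obtain ⟨y, rfl⟩ := (h x).2 f
    refine ⟨DFinsupp.support y, ?_⟩
    have hy : coproductComparison t x y = ∑ i ∈ DFinsupp.support y, y i ≫ Sigma.ι x i := by
      conv_lhs => rw [← DirectSum.sum_support_of y]
      simp only [map_sum, coproductComparison_of]
    rw [hy]
    exact sum_comp_sigmaProj x _ fun i => y i
  · intro h ι x
    refine ⟨fun y z hyz => DFinsupp.ext fun i => ?_, fun f => ?_⟩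
    · have := coproductComparison_π t x y i
      rw [hyz, coproductComparison_π] at this
      exact this.symm
    · obtain ⟨J, hJ⟩ := h x f
      refine ⟨∑ i ∈ J, DirectSum.of (fun i => (t ⟶ x i)) i (f ≫ sigmaπ x i), ?_⟩
      rw [map_sum]
      simp only [coproductComparison_of]
      conv_rhs => rw [← hJ, sigmaProj, Preadditive.comp_sum]
      simp only [Category.assoc]

lemma IsCompactObj.of_sum {t : D}
    (h : ∀ {ι : Type v} (x : ι → D) (f : t ⟶ ∐ x),
      ∃ (J : Finset ι) (g : ∀ i, t ⟶ x i), f = ∑ i ∈ J, g i ≫ Sigma.ι x i) :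
    IsCompactObj t := by
  refine (isCompactObj_iff t).2 fun x f => ?_
  obtain ⟨J, g, rfl⟩ := h x f
  exact ⟨J, sum_comp_sigmaProj x J g⟩

lemma IsCompactObj.exists_sum {t : D} (h : IsCompactObj t) {ι : Type v} (x : ι → D)
    (f : t ⟶ ∐ x) :
    ∃ (J : Finset ι) (g : ∀ i, t ⟶ x i), f = ∑ i ∈ J, g i ≫ Sigma.ι x i := by
  obtain ⟨J, hJ⟩ := (isCompactObj_iff t).1 h x f
  refine ⟨J, fun i => f ≫ sigmaπ x i, ?_⟩
  conv_lhs => rw [← hJ, sigmaProj, Preadditive.comp_sum]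
  simp only [Category.assoc]

lemma IsCompactObj.of_isZero {t : D} (h : IsZero t) : IsCompactObj t :=
  (isCompactObj_iff _).2 fun _ _ => ⟨∅, h.eq_of_src _ _⟩

lemma IsCompactObj.of_iso {s t : D} (e : s ≅ t) (h : IsCompactObj s) : IsCompactObj t := by
  refine (isCompactObj_iff _).2 fun x f => ?_
  obtain ⟨J, hJ⟩ := (isCompactObj_iff _).1 h x (e.hom ≫ f)
  exact ⟨J, by rwa [Category.assoc, cancel_epi] at hJ⟩

/-- The composite `X 0 ⟶ X m` of a sequence of morphisms. -/
def towerMap (X : ℕ → D) (a : ∀ n, X n ⟶ X (n + 1)) : ∀ m, X 0 ⟶ X m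
  | 0 => 𝟙 _
  | m + 1 => towerMap X a m ≫ a m

/-- The endomorphism of the coproduct of a sequence induced by its transition morphisms. -/
noncomputable def towerShift (X : ℕ → D) (a : ∀ n, X n ⟶ X (n + 1)) :
    (∐ fun i : ULift.{v} ℕ => X i.down) ⟶ ∐ fun i : ULift.{v} ℕ => X i.down :=
  Sigma.desc fun i => a i.down ≫ Sigma.ι (fun i : ULift.{v} ℕ => X i.down) ⟨i.down + 1⟩

lemma towerShift_π_zero (X : ℕ → D) (a : ∀ n, X n ⟶ X (n + 1)) :
    towerShift X a ≫ sigmaπ (fun i : ULift.{v} ℕ => X i.down) ⟨0⟩ = 0 := by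
  refine Sigma.hom_ext _ _ fun i => ?_
  rw [towerShift, Sigma.ι_desc_assoc, Category.assoc, ι_sigmaπ_of_ne _ (by simp), comp_zero,
    comp_zero]

lemma towerShift_π_succ (X : ℕ → D) (a : ∀ n, X n ⟶ X (n + 1)) (k : ℕ) :
    towerShift X a ≫ sigmaπ (fun i : ULift.{v} ℕ => X i.down) ⟨k + 1⟩ =
      sigmaπ (fun i : ULift.{v} ℕ => X i.down) ⟨k⟩ ≫ a k := by
  refine Sigma.hom_ext _ _ fun ⟨i⟩ => ?_
  rw [towerShift, Sigma.ι_desc_assoc, Category.assoc]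
  by_cases h : i = k
  · subst h
    rw [ι_sigmaπ_self, ι_sigmaπ_self_assoc, Category.comp_id]
  · rw [ι_sigmaπ_of_ne _ (by simpa using h), ι_sigmaπ_of_ne_assoc _ (by simpa using h),
      comp_zero]

end Sigma

variable {D : Type u} [Category.{v} D] [Preadditive D] [HasZeroObject D] [HasShift D ℤ]
  [∀ n : ℤ, (shiftFunctor D n).Additive] [Pretriangulated D]

/-- A triangulated subcategory as an object property. -/
def memProperty (A : Set D) : ObjectProperty D := fun X => X ∈ A

lemma IsTriangulatedSub.isClosedUnderIsomorphisms {A : Set D} (hA : IsTriangulatedSub A) :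
    (memProperty A).IsClosedUnderIsomorphisms :=
  ⟨fun e h => hA.iso_closed e h⟩

lemma IsTriangulatedSub.shift_mem {A : Set D} (hA : IsTriangulatedSub A) {X : D} (hX : X ∈ A)
    (n : ℤ) : X⟦n⟧ ∈ A := by
  induction n with
  | zero => exact hA.iso_closed ((shiftFunctorZero D ℤ).symm.app X) hX
  | succ n ih =>
    exact hA.iso_closed ((shiftFunctorAdd' D (n : ℤ) 1 _ rfl).symm.app X)
      (hA.two_of_three₃ _ (contractible_distinguished₂ (X⟦(n : ℤ)⟧)) ih hA.zero_mem)
  | pred n ih =>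
    exact hA.two_of_three₁ _ (contractible_distinguished₂ (X⟦(-n - 1 : ℤ)⟧)) hA.zero_mem
      (hA.iso_closed ((shiftFunctorAdd' D (-n - 1 : ℤ) 1 _ (by lia)).app X) ih)

lemma IsTriangulatedSub.isTriangulated {A : Set D} (hA : IsTriangulatedSub A) :
    (memProperty A).IsTriangulated := by
  have := hA.isClosedUnderIsomorphisms
  exact
    { exists_zero := ⟨0, isZero_zero D, hA.zero_mem⟩
      isStableUnderShiftBy := fun n => ⟨fun _ h => hA.shift_mem h n⟩
      toIsTriangulatedClosed₂ := .mk' hA.two_of_three₂ }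

section DistTriang

variable {X Y Z : D} {f : X ⟶ Y} {g : Y ⟶ Z} {h : Z ⟶ X⟦(1 : ℤ)⟧}

lemma exists_lift_left (hT : Triangle.mk f g h ∈ distTriang D) {W : D} (k : W ⟶ Y)
    (hk : k ≫ g = 0) : ∃ l : W ⟶ X, l ≫ f = k := by
  obtain ⟨l, hl⟩ := Triangle.coyoneda_exact₂ _ hT k hk
  exact ⟨l, hl.symm⟩

lemma exists_lift_middle (hT : Triangle.mk f g h ∈ distTriang D) {W : D} (k : W ⟶ Z)
    (hk : k ≫ h = 0) : ∃ l : W ⟶ Y, l ≫ g = k := by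
  obtain ⟨l, hl⟩ := Triangle.coyoneda_exact₃ _ hT k hk
  exact ⟨l, hl.symm⟩

lemma exists_desc_right (hT : Triangle.mk f g h ∈ distTriang D) {W : D} (k : Y ⟶ W)
    (hk : f ≫ k = 0) : ∃ l : Z ⟶ W, g ≫ l = k := by
  obtain ⟨l, hl⟩ := Triangle.yoneda_exact₂ _ hT k hk
  exact ⟨l, hl.symm⟩

lemma exists_desc_middle (hT : Triangle.mk f g h ∈ distTriang D) {W : D} (k : X ⟶ W)
    (hk : h ≫ k⟦(1 : ℤ)⟧' = 0) : ∃ l : Y ⟶ W, f ≫ l = k := by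
  obtain ⟨l, hl, -⟩ := complete_distinguished_triangle_morphism₂ _ _ hT
    (contractible_distinguished W) k 0 (hk.trans zero_comp.symm)
  exact ⟨l, hl.trans (Category.comp_id k)⟩

end DistTriang

section Factorization

variable {P : ObjectProperty D} [P.IsTriangulated] [P.IsClosedUnderIsomorphisms]

lemma FactorsVia.zero (X Y : D) : FactorsVia P (0 : X ⟶ Y) :=
  ⟨0, 0, 0, P.prop_zero, zero_comp⟩

lemma FactorsVia.add {X Y : D} {f g : X ⟶ Y} (hf : FactorsVia P f) (hg : FactorsVia P g) :
    FactorsVia P (f + g) := by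
  obtain ⟨Z, a, b, hZ, rfl⟩ := hf
  obtain ⟨W, a', b', hW, rfl⟩ := hg
  refine ⟨Z ⊞ W, biprod.lift a a', biprod.desc b b', ?_, by simp⟩
  exact P.ext_of_isTriangulatedClosed₂ _ (binaryBiproductTriangle_distinguished Z W) hZ hW

lemma FactorsVia.sum {X Y : D} {ι : Type*} (J : Finset ι) (f : ι → (X ⟶ Y))
    (h : ∀ i, FactorsVia P (f i)) : FactorsVia P (∑ i ∈ J, f i) :=
  Finset.sum_induction _ (FactorsVia P) (fun _ _ => .add) (.zero X Y) fun i _ => h i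

/-- If the restriction of `f : T ⟶ X` to the fibre of a morphism to an object of `P`
factors through `P`, then so does `f`. -/
lemma FactorsVia.of_distTriang {S T Z X : D} {i : S ⟶ T} {p : T ⟶ Z} {d : Z ⟶ S⟦(1 : ℤ)⟧}
    (hT : Triangle.mk i p d ∈ distTriang D) (hZ : P Z) (f : T ⟶ X)
    (hf : FactorsVia P (i ≫ f)) : FactorsVia P f := by
  obtain ⟨Y, a, b, hY, hab⟩ := hf
  obtain ⟨Q, j, r, hQ⟩ := distinguished_cocone_triangle₂ (d ≫ a⟦1⟧')
  have hPQ : P Q := P.ext_of_isTriangulatedClosed₂ _ hQ hY hZ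
  obtain ⟨q, hq⟩ : ∃ q : T ⟶ Q, i ≫ q = a ≫ j := by
    obtain ⟨q, hq, -⟩ := complete_distinguished_triangle_morphism₂ _ _ hT hQ a (𝟙 Z)
      (Category.id_comp _).symm
    exact ⟨q, hq⟩
  have hdi : d ≫ i⟦(1 : ℤ)⟧' = 0 := comp_distTriang_mor_zero₃₁ _ hT
  obtain ⟨e, he⟩ := exists_desc_middle hQ b (by
    rw [Category.assoc, ← Functor.map_comp, hab, Functor.map_comp, ← Category.assoc, hdi,
      zero_comp])
  obtain ⟨g, hg⟩ := exists_desc_right hT (f - q ≫ e) (by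
    rw [Preadditive.comp_sub, ← hab, ← he, ← Category.assoc i, hq, Category.assoc, sub_self])
  rw [← sub_add_cancel f (q ≫ e), ← hg]
  exact .add ⟨_, _, _, hZ, rfl⟩ ⟨_, _, _, hPQ, rfl⟩

end Factorization

variable [HasCoproducts.{v} D]

section Compact

lemma IsCompactObj.shift {t : D} (h : IsCompactObj t) (n : ℤ) : IsCompactObj (t⟦n⟧) := by
  refine IsCompactObj.of_sum fun x f => ?_
  have : (shiftEquiv D n).functor.Additive :=
    inferInstanceAs (shiftFunctor D n).Additive
  let adj := (shiftEquiv D n).toAdjunction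
  let G := (shiftEquiv D n).inverse
  obtain ⟨J, g, hg⟩ := IsCompactObj.exists_sum h (fun i => G.obj (x i))
    (adj.homEquiv t (∐ x) f ≫ (PreservesCoproduct.iso G x).hom)
  refine ⟨J, fun i => (adj.homEquiv t (x i)).symm (g i), ?_⟩
  have key : adj.homEquiv t (∐ x) f = ∑ i ∈ J, g i ≫ G.map (Sigma.ι x i) := by
    rw [← cancel_mono (PreservesCoproduct.iso G x).hom, hg, Preadditive.sum_comp]
    refine Finset.sum_congr rfl fun i _ => ?_
    rw [Category.assoc, ← ι_comp_sigmaComparison, Category.assoc, ← PreservesCoproduct.inv_hom,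
      Iso.inv_hom_id, Category.comp_id]
  have : adj.homAddEquiv t (∐ x) f =
      adj.homAddEquiv t (∐ x) (∑ i ∈ J, (adj.homEquiv t (x i)).symm (g i) ≫ Sigma.ι x i) := by
    rw [map_sum]
    simp only [Adjunction.homAddEquiv_apply, Adjunction.homEquiv_naturality_right,
      Equiv.apply_symm_apply]
    exact key
  exact (adj.homAddEquiv t (∐ x)).injective this

lemma IsCompactObj.of_distTriang (T : Triangle D) (hT : T ∈ distTriang D)
    (h₁ : IsCompactObj T.obj₁) (h₃ : IsCompactObj T.obj₃) : IsCompactObj T.obj₂ := by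
  classical
  refine (isCompactObj_iff _).2 fun x f => ?_
  obtain ⟨J, hJ⟩ := (isCompactObj_iff _).1 h₁ x (T.mor₁ ≫ f)
  obtain ⟨g, hg⟩ := T.yoneda_exact₂ hT (f - f ≫ sigmaProj x J) (by
    rw [Preadditive.comp_sub, ← Category.assoc, hJ, sub_self])
  obtain ⟨K, hK⟩ := (isCompactObj_iff _).1 h₃ x g
  refine ⟨J ∪ K, ?_⟩
  have hf : f = f ≫ sigmaProj x J + (T.mor₂ ≫ g) ≫ sigmaProj x K := by
    rw [Category.assoc, hK, ← hg, add_sub_cancel]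
  rw [hf, Preadditive.add_comp, Category.assoc, Category.assoc,
    sigmaProj_comp_of_subset x Finset.subset_union_left,
    sigmaProj_comp_of_subset x Finset.subset_union_right]

variable (D) in
/-- The compact objects, as an object property. -/
def compactObjProperty : ObjectProperty D := fun t => IsCompactObj t

instance : (compactObjProperty D).IsClosedUnderIsomorphisms where
  of_iso e h := IsCompactObj.of_iso e h

instance : (compactObjProperty D).IsTriangulated where
  exists_zero := ⟨0, isZero_zero D, IsCompactObj.of_isZero (isZero_zero D)⟩
  isStableUnderShiftBy n := ⟨fun _ h => IsCompactObj.shift h n⟩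
  toIsTriangulatedClosed₂ := .mk' IsCompactObj.of_distTriang

end Compact

section Tower

variable {U : D} (X : ℕ → D) (a : ∀ n, X n ⟶ X (n + 1))

lemma comp_towerShift_eq_zero (hU : IsCompactObj U)
    (ha : ∀ m (n : ℤ) (f : U⟦n⟧ ⟶ X m), f ≫ a m = 0) (n : ℤ)
    (g : U⟦n⟧ ⟶ ∐ fun i : ULift.{v} ℕ => X i.down) : g ≫ towerShift X a = 0 := by
  obtain ⟨J, g, rfl⟩ := IsCompactObj.exists_sum (IsCompactObj.shift hU n) _ g
  rw [Preadditive.sum_comp]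
  refine Finset.sum_eq_zero fun i _ => ?_
  rw [Category.assoc, towerShift, Sigma.ι_desc, ← Category.assoc, ha, zero_comp]

lemma isIso_id_sub_towerShift (hU : IsCompactObj U)
    (hgen : ∀ x : D, (∀ n : ℤ, ∀ f : (U⟦n⟧ ⟶ x), f = 0) → IsZero x)
    (ha : ∀ m (n : ℤ) (f : U⟦n⟧ ⟶ X m), f ≫ a m = 0) :
    IsIso (𝟙 _ - towerShift X a) := by
  obtain ⟨H, p, d, hT⟩ := distinguished_cocone_triangle (𝟙 _ - towerShift X a)
  refine (Triangle.isZero₃_iff_isIso₁ _ hT).1 (hgen _ fun n (f : U⟦n⟧ ⟶ H) => ?_)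
  have hd : f ≫ d = 0 := by
    let e : U⟦n⟧ ≅ (U⟦n - 1⟧)⟦(1 : ℤ)⟧ :=
      (shiftFunctorAdd' D (n - 1) 1 n (by lia)).app U
    obtain ⟨g, hg⟩ := (shiftFunctor D (1 : ℤ)).map_surjective (e.inv ≫ f ≫ d)
    have h0 : g ≫ (𝟙 _ - towerShift X a) = 0 := by
      apply (shiftFunctor D (1 : ℤ)).map_injective
      have : d ≫ (𝟙 _ - towerShift X a)⟦(1 : ℤ)⟧' = 0 := comp_distTriang_mor_zero₃₁ _ hT
      rw [Functor.map_comp, hg, Category.assoc, Category.assoc, this]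
      simp
    rw [Preadditive.comp_sub, comp_towerShift_eq_zero X a hU ha, Category.comp_id, sub_zero] at h0
    rw [h0, Functor.map_zero] at hg
    rw [← cancel_epi e.inv, ← hg, comp_zero]
  obtain ⟨g, rfl⟩ := exists_lift_middle hT f hd
  have hg : g ≫ (𝟙 _ - towerShift X a) = g := by
    rw [Preadditive.comp_sub, comp_towerShift_eq_zero X a hU ha, Category.comp_id, sub_zero]
  have : (𝟙 _ - towerShift X a) ≫ p = 0 := comp_distTriang_mor_zero₁₂ _ hT
  change g ≫ p = 0
  rw [← hg, Category.assoc, this, comp_zero]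

lemma exists_comp_towerMap_eq_zero (hU : IsCompactObj U)
    (hgen : ∀ x : D, (∀ n : ℤ, ∀ f : (U⟦n⟧ ⟶ x), f = 0) → IsZero x)
    (ha : ∀ m (n : ℤ) (f : U⟦n⟧ ⟶ X m), f ≫ a m = 0)
    {t : D} (ht : IsCompactObj t) (f : t ⟶ X 0) :
    ∃ m, f ≫ towerMap X a m = 0 := by
  have := isIso_id_sub_towerShift X a hU hgen ha
  let x : ULift.{v} ℕ → D := fun i => X i.down
  obtain ⟨u, hu⟩ : ∃ u : t ⟶ ∐ x, u ≫ (𝟙 _ - towerShift X a) = f ≫ Sigma.ι x ⟨0⟩ :=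
    ⟨(f ≫ Sigma.ι x ⟨0⟩) ≫ inv (𝟙 _ - towerShift X a), by
      rw [Category.assoc, IsIso.inv_hom_id, Category.comp_id]⟩
  have hcomp (k : ℕ) : u ≫ sigmaπ x ⟨k⟩ = f ≫ towerMap X a k := by
    induction k with
    | zero =>
      have := hu =≫ sigmaπ x ⟨0⟩
      rw [Category.assoc, Preadditive.sub_comp, towerShift_π_zero, Category.id_comp, sub_zero,
        Category.assoc, ι_sigmaπ_self] at this
      exact this
    | succ k ih =>
      have := hu =≫ sigmaπ x ⟨k + 1⟩
      rw [Category.assoc, Preadditive.sub_comp, towerShift_π_succ, Category.id_comp,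
        Category.assoc, ι_sigmaπ_of_ne _ (by simp), comp_zero, Preadditive.comp_sub,
        sub_eq_zero] at this
      rw [this, ← Category.assoc, ih, Category.assoc, towerMap]
  obtain ⟨J, hJ⟩ := (isCompactObj_iff t).1 ht x u
  obtain ⟨⟨m⟩, hm⟩ := Infinite.exists_notMem_finset J
  exact ⟨m, by rw [← hcomp, ← hJ, Category.assoc, sigmaProj_π_of_notMem x hm, comp_zero]⟩

end Tower

section Attach

variable (U : D)

/-- The coproduct of shifts of `U` indexed by all morphisms from shifts of `U` to `X`. -/
noncomputable abbrev cells (X : D) : D := ∐ fun p : Σ n : ℤ, (U⟦n⟧ ⟶ X) => U⟦p.1⟧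

/-- The tautological morphism `cells U X ⟶ X`. -/
noncomputable def cellsDesc (X : D) : cells U X ⟶ X := Sigma.desc fun p => p.2

/-- The cone of `cellsDesc U X`. -/
noncomputable def attach (X : D) : D := (distinguished_cocone_triangle (cellsDesc U X)).choose

/-- The canonical morphism to the cone of `cellsDesc U X`. -/
noncomputable def toAttach (X : D) : X ⟶ attach U X :=
  (distinguished_cocone_triangle (cellsDesc U X)).choose_spec.choose

lemma exists_attach_distinguished (X : D) :
    ∃ d, Triangle.mk (cellsDesc U X) (toAttach U X) d ∈ distTriang D :=
  (distinguished_cocone_triangle (cellsDesc U X)).choose_spec.choose_spec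

lemma comp_toAttach_eq_zero {X : D} {n : ℤ} (f : U⟦n⟧ ⟶ X) : f ≫ toAttach U X = 0 := by
  obtain ⟨d, hd⟩ := exists_attach_distinguished U X
  have h : cellsDesc U X ≫ toAttach U X = 0 := comp_distTriang_mor_zero₁₂ _ hd
  have hf : Sigma.ι (fun p : Σ n : ℤ, (U⟦n⟧ ⟶ X) => U⟦p.1⟧) ⟨n, f⟩ ≫ cellsDesc U X = f := by
    simp [cellsDesc]
  rw [← hf, Category.assoc, h, comp_zero]

/-- The sequence of objects obtained from `X` by iterating `attach U`. -/
noncomputable def attachTower (X : D) : ℕ → D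
  | 0 => X
  | n + 1 => attach U (attachTower X n)

/-- The transition morphisms of `attachTower U X`. -/
noncomputable def attachTowerMap (X : D) (n : ℕ) :
    attachTower U X n ⟶ attachTower U X (n + 1) :=
  toAttach U (attachTower U X n)

variable {U} {P : ObjectProperty D} [P.IsTriangulated] [P.IsClosedUnderIsomorphisms]

lemma FactorsVia.of_comp_towerMap (hP : P ≤ compactObjProperty D) (hPU : P U) (X : D) (m : ℕ)
    {s : D} (hs : IsCompactObj s) (f : s ⟶ attachTower U X 0)
    (hf : f ≫ towerMap (attachTower U X) (attachTowerMap U X) m = 0) : FactorsVia P f := by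
  induction m generalizing s with
  | zero =>
    have hf' : f ≫ 𝟙 _ = 0 := hf
    rw [Category.comp_id] at hf'
    rw [hf']
    exact .zero _ _
  | succ m ih =>
    obtain ⟨d, hd⟩ := exists_attach_distinguished U (attachTower U X m)
    obtain ⟨g, hg⟩ := exists_lift_left hd
      (f ≫ towerMap (attachTower U X) (attachTowerMap U X) m) ((Category.assoc _ _ _).trans hf)
    have hgP : FactorsVia P g := by
      obtain ⟨J, k, rfl⟩ := IsCompactObj.exists_sum hs _ g
      exact .sum J _ fun i => ⟨_, _, _, P.le_shift i.1 _ hPU, rfl⟩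
    obtain ⟨Z, α, β, hZ, rfl⟩ := hgP
    obtain ⟨Y, i, δ, hT⟩ := distinguished_cocone_triangle₁ α
    have hY : IsCompactObj Y :=
      (compactObjProperty D).ext_of_isTriangulatedClosed₁ _ hT hs (hP _ hZ)
    refine FactorsVia.of_distTriang hT hZ f (ih hY _ ?_)
    have : i ≫ α = 0 := comp_distTriang_mor_zero₁₂ _ hT
    rw [Category.assoc, ← hg, Category.assoc, ← Category.assoc i, this, zero_comp]

/-- If `U` is a compact generator, every compact object is a direct summand of an object of any
triangulated subcategory of compact objects containing `U`. -/
lemma factorsVia_id_of_isCompactObj (hP : P ≤ compactObjProperty D) (hPU : P U)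
    (hgen : ∀ x : D, (∀ n : ℤ, ∀ f : (U⟦n⟧ ⟶ x), f = 0) → IsZero x)
    {t : D} (ht : IsCompactObj t) : FactorsVia P (𝟙 t) := by
  obtain ⟨m, hm⟩ := exists_comp_towerMap_eq_zero (attachTower U t) (attachTowerMap U t)
    (hP _ hPU) hgen (fun _ _ f => comp_toAttach_eq_zero U f) ht (𝟙 t)
  exact .of_comp_towerMap hP hPU t m ht _ hm

end Attach

/-- If the unit is compact and compactly generates `T`, then every thick
subcategory of `T^c` is a tensor ideal of `T^c`. -/
theorem thick_isTensorIdeal_of_unit_generator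
    (h1 : IsCompactObj (𝟙_ C))
    (hgen : ∀ x : C, (∀ n : ℤ, ∀ f : ((𝟙_ C)⟦n⟧ ⟶ x), f = 0) → IsZero x)
    (A : Set C) (hthick : IsThick A) (hcpt : A ⊆ compacts C) :
    ∀ c ∈ A, ∀ t ∈ compacts C, t ⊗ c ∈ A := by
  intro c hc t ht
  have hiso := hthick.1.isClosedUnderIsomorphisms
  have htri := hthick.1.isTriangulated
  have hunit : (memProperty A).inverseImage (tensorRight c) (𝟙_ C) :=
    hthick.1.iso_closed (λ_ c).symm hc
  obtain ⟨Z, a, b, ⟨hZ, -⟩, hab⟩ := factorsVia_id_of_isCompactObj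
    (P := (memProperty A).inverseImage (tensorRight c) ⊓ compactObjProperty C)
    inf_le_right ⟨hunit, h1⟩ hgen ht
  exact hthick.2 ⟨a ▷ c, b ▷ c, by rw [← comp_whiskerRight, hab, id_whiskerRight]⟩ hZ

end Paper
end

section
/- Let T be a tensor triangulated category and let S be a Bousfield subcategory of T which is a tensor ideal. Fix a distinguished triangle Γ(1) → 1 → L(1) → Γ(1)[1] with Γ(1) ∈ S and L(1) ∈ S^⊥. If t is a rigid object of T, then Γ(1) ⊗ t ∈ S and L(1) ⊗ t ∈ S^⊥; consequently the distinguished triangle Γ(1) ⊗ t → t → L(1) ⊗ t → (Γ(1) ⊗ t)[1], obtained by tensoring the fixed triangle with t (using 1 ⊗ t ≅ t), is an approximation triangle of t, and for any approximation triangle Γ(t) → t → L(t) → Γ(t)[1] one has L(1) ⊗ t ≅ L(t). -/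
open CategoryTheory Category Limits Pretriangulated ZeroObject MonoidalCategory

universe v u u₂

namespace Paper

variable {C : Type u} [Category.{v} C] [Preadditive C] [HasZeroObject C] [HasShift C ℤ]
  [∀ n : ℤ, (shiftFunctor C n).Additive] [Pretriangulated C] [IsTriangulated C]
  [HasCoproducts.{v} C]

variable [MonoidalCategory C] [SymmetricCategory C]
  [∀ X : C, (tensorLeft X).CommShift ℤ]
  [∀ X : C, (tensorRight X).CommShift ℤ]
  [∀ X : C, (tensorLeft X).IsTriangulated]
  [∀ X : C, (tensorRight X).IsTriangulated]
  [∀ (X : C) (ι : Type v), PreservesColimitsOfShape (Discrete ι) (tensorLeft X)]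
  [∀ (X : C) (ι : Type v), PreservesColimitsOfShape (Discrete ι) (tensorRight X)]

/-- The right orthogonal `S^⊥` of a class of objects `S`. -/
def rightOrth (S : Set C) : Set C :=
  {t : C | ∀ s ∈ S, ∀ f : s ⟶ t, f = 0}

/-- An object is rigid (strongly dualizable) if it admits a dual, i.e. there is an
exact pairing with some object. -/
def IsRigid (d : C) : Prop := ∃ e : C, Nonempty (ExactPairing d e)

/-- A Bousfield subcategory: a triangulated subcategory `S` such that every object `t` fits
in a distinguished triangle `Γ(t) → t → L(t) → Γ(t)[1]` with `Γ(t) ∈ S` and `L(t) ∈ S^⊥`. -/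
def IsBousfield (S : Set C) : Prop :=
  IsTriangulatedSub S ∧
    ∀ t : C, ∃ T, (T ∈ distTriang C) ∧ T.obj₂ = t ∧ T.obj₁ ∈ S ∧ T.obj₃ ∈ rightOrth S

section Approximation

variable {E : Type*} [Category E] [Preadditive E] [HasZeroObject E] [HasShift E ℤ]
  [∀ n : ℤ, (shiftFunctor E n).Additive] [Pretriangulated E] {S : Set E}

theorem IsTriangulatedSub.shift_mem_s8 (hS : IsTriangulatedSub S) {X : E} (hX : X ∈ S) :
    X⟦(1 : ℤ)⟧ ∈ S :=
  hS.two_of_three₃ _ (contractible_distinguished₂ X) hX hS.zero_mem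

/-- A morphism out of the third vertex of a distinguished triangle with first vertex in `S`
into an object of `S^⊥` is determined by its composition with `T.mor₂`. -/
theorem IsTriangulatedSub.hom_ext_of_rightOrth (hS : IsTriangulatedSub S) {T : Triangle E}
    (hT : T ∈ distTriang E) (h₁ : T.obj₁ ∈ S) {L : E} (hL : L ∈ rightOrth S)
    {c d : T.obj₃ ⟶ L} (h : T.mor₂ ≫ c = T.mor₂ ≫ d) : c = d := by
  obtain ⟨g, hg⟩ := T.yoneda_exact₃ hT (c - d) (by rw [Preadditive.comp_sub, h, sub_self])
  rw [← sub_eq_zero, hg, hL _ (hS.shift_mem_s8 h₁) g, comp_zero]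

/-- The third vertices of two approximation triangles of isomorphic objects are isomorphic. -/
theorem IsTriangulatedSub.nonempty_iso_obj₃ (hS : IsTriangulatedSub S) {T T' : Triangle E}
    (hT : T ∈ distTriang E) (hT' : T' ∈ distTriang E) (h₁ : T.obj₁ ∈ S) (h₁' : T'.obj₁ ∈ S)
    (h₃ : T.obj₃ ∈ rightOrth S) (h₃' : T'.obj₃ ∈ rightOrth S)
    (e : T.obj₂ ≅ T'.obj₂) : Nonempty (T.obj₃ ≅ T'.obj₃) := by
  obtain ⟨c, hc⟩ := T.yoneda_exact₂ hT (e.hom ≫ T'.mor₂) (h₃' _ h₁ _)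
  obtain ⟨d, hd⟩ := T'.yoneda_exact₂ hT' (e.inv ≫ T.mor₂) (h₃ _ h₁' _)
  refine ⟨⟨c, d, hS.hom_ext_of_rightOrth hT h₁ h₃ ?_,
    hS.hom_ext_of_rightOrth hT' h₁' h₃' ?_⟩⟩
  · rw [← assoc, ← hc, assoc, ← hd, e.hom_inv_id_assoc, comp_id]
  · rw [← assoc, ← hd, assoc, ← hc, e.inv_hom_id_assoc, comp_id]

/-- Replacing the middle vertex of a distinguished triangle by an isomorphic object. -/
theorem distinguished_of_iso_obj₂ {T : Triangle E} (hT : T ∈ distTriang E) {X : E}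
    (e : T.obj₂ ≅ X) : Triangle.mk (T.mor₁ ≫ e.hom) (e.inv ≫ T.mor₂) T.mor₃ ∈ distTriang E :=
  isomorphic_distinguished _ hT _ (Triangle.isoMk _ _ (Iso.refl T.obj₁) e.symm
    (Iso.refl T.obj₃) (show (T.mor₁ ≫ e.hom) ≫ e.inv = 𝟙 _ ≫ T.mor₁ by simp)
    (show (e.inv ≫ T.mor₂) ≫ 𝟙 _ = e.inv ≫ T.mor₂ by simp)
    (show T.mor₃ ≫ (𝟙 T.obj₁)⟦1⟧' = 𝟙 _ ≫ T.mor₃ by simp))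

end Approximation

/-- Tensoring with a rigid object preserves the right orthogonal of a tensor ideal. -/
theorem IsRigid.tensor_mem_rightOrth {D : Type*} [Category D] [Preadditive D]
    [MonoidalCategory D] [BraidedCategory D] {S : Set D}
    (hideal : ∀ s ∈ S, ∀ t : D, s ⊗ t ∈ S) {t : D} (ht : IsRigid t) {L : D}
    (hL : L ∈ rightOrth S) : L ⊗ t ∈ rightOrth S := by
  obtain ⟨e, ⟨p⟩⟩ := ht
  let _ : ExactPairing e t := BraidedCategory.exactPairing_swap t e
  intro s hs f
  apply (tensorRightHomEquiv s e t L).symm.injective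
  rw [hL _ (hideal s hs e) ((tensorRightHomEquiv s e t L).symm f),
    hL _ (hideal s hs e) ((tensorRightHomEquiv s e t L).symm 0)]

/-- Let `S` be a Bousfield tensor ideal with idempotent triangle
`Γ(1) → 1 → L(1) → Γ(1)[1]`. For a rigid object `t`: `Γ(1) ⊗ t ∈ S`, `L(1) ⊗ t ∈ S^⊥`,
the tensored triangle is an approximation triangle of `t`, and for any approximation
triangle of `t` one has `L(1) ⊗ t ≅ L(t)`. -/
theorem rigid_local_tensor (S : Set C) (hS : IsBousfield S)
    (hideal : ∀ s ∈ S, ∀ t : C, s ⊗ t ∈ S)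
    (T₀ : Triangle C) (hT₀ : T₀ ∈ distTriang C) (h₂ : T₀.obj₂ = 𝟙_ C)
    (hΓ : T₀.obj₁ ∈ S) (hL : T₀.obj₃ ∈ rightOrth S)
    (t : C) (ht : IsRigid t) :
    T₀.obj₁ ⊗ t ∈ S ∧ T₀.obj₃ ⊗ t ∈ rightOrth S ∧
      (∃ T, (T ∈ distTriang C) ∧
        T.obj₁ = T₀.obj₁ ⊗ t ∧ T.obj₂ = t ∧ T.obj₃ = T₀.obj₃ ⊗ t) ∧
      ∀ T, (T ∈ distTriang C) → T.obj₂ = t → T.obj₁ ∈ S → T.obj₃ ∈ rightOrth S →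
        Nonempty (T₀.obj₃ ⊗ t ≅ T.obj₃) := by
  have hΓt := hideal _ hΓ t
  have hLt := ht.tensor_mem_rightOrth hideal hL
  have hT := (tensorRight t).map_distinguished T₀ hT₀
  let e : T₀.obj₂ ⊗ t ≅ t := whiskerRightIso (eqToIso h₂) t ≪≫ λ_ t
  exact ⟨hΓt, hLt, ⟨_, distinguished_of_iso_obj₂ hT e, rfl, rfl, rfl⟩, fun T hT' h₂' h₁' h₃' ↦
    hS.1.nonempty_iso_obj₃ hT hT' hΓt h₁' hLt h₃' (e ≪≫ eqToIso h₂'.symm)⟩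

end Paper
end

section
/- Let T be a tensor triangulated category and let S be a Bousfield subcategory of T which is a tensor ideal. Fix a distinguished triangle Γ(1) → 1 → L(1) → Γ(1)[1] with Γ(1) ∈ S and L(1) ∈ S^⊥, and suppose that L(1) ⊗ t ∈ S^⊥ for every object t of T. Then the right orthogonal S^⊥ is a tensor ideal of T, and S is smashing, i.e., S^⊥ is closed under small coproducts. -/
open CategoryTheory Category Limits Pretriangulated ZeroObject MonoidalCategory

universe v u u₂

namespace Paper

variable {C : Type u} [Category.{v} C] [Preadditive C] [HasZeroObject C] [HasShift C ℤ]
  [∀ n : ℤ, (shiftFunctor C n).Additive] [Pretriangulated C] [IsTriangulated C]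
  [HasCoproducts.{v} C]

variable [MonoidalCategory C] [SymmetricCategory C]
  [∀ X : C, (tensorLeft X).CommShift ℤ]
  [∀ X : C, (tensorRight X).CommShift ℤ]
  [∀ X : C, (tensorLeft X).IsTriangulated]
  [∀ X : C, (tensorRight X).IsTriangulated]
  [∀ (X : C) (ι : Type v), PreservesColimitsOfShape (Discrete ι) (tensorLeft X)]
  [∀ (X : C) (ι : Type v), PreservesColimitsOfShape (Discrete ι) (tensorRight X)]

theorem IsTriangulatedSub.shift_one_mem {E : Type*} [Category E] [Preadditive E]
    [HasZeroObject E] [HasShift E ℤ] [∀ n : ℤ, (shiftFunctor E n).Additive] [Pretriangulated E]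
    {S : Set E} (hS : IsTriangulatedSub S) {X : E} (hX : X ∈ S) :
    X⟦(1 : ℤ)⟧ ∈ S :=
  hS.two_of_three₃ _ (rot_of_distTriang _ (contractible_distinguished X)) hX hS.zero_mem

theorem mem_rightOrth_of_iso {E : Type*} [Category E] [Preadditive E] {S : Set E} {X Y : E}
    (e : X ≅ Y) (hX : ∀ s ∈ S, ∀ f : s ⟶ X, f = 0) (s : E) (hs : s ∈ S) (f : s ⟶ Y) :
    f = 0 := by
  rw [← cancel_mono e.inv, zero_comp]
  exact hX s hs _

/-- If the first term and its shift admit only zero maps to the second and third terms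
respectively, then the first term vanishes. -/
theorem isZero_obj₁_of_hom_eq_zero {E : Type*} [Category E] [Preadditive E]
    [HasZeroObject E] [HasShift E ℤ] [∀ n : ℤ, (shiftFunctor E n).Additive] [Pretriangulated E]
    (T : Triangle E) (hT : T ∈ distTriang E) (h₁ : T.mor₁ = 0)
    (h : ∀ f : T.obj₁⟦(1 : ℤ)⟧ ⟶ T.obj₃, f = 0) : IsZero T.obj₁ := by
  obtain ⟨g, hg⟩ := Triangle.coyoneda_exact₁ T hT (𝟙 (T.obj₁⟦(1 : ℤ)⟧)) (by simp [h₁])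
  rw [h g, zero_comp] at hg
  rw [IsZero.iff_id_eq_zero]
  apply (shiftFunctor E (1 : ℤ)).map_injective
  simpa using hg

/-- An object is right orthogonal to `S` exactly when it is annihilated by `Γ(1)`. -/
theorem mem_rightOrth_iff_isZero_tensor {E : Type u} [Category.{v} E] [Preadditive E]
    [HasZeroObject E] [HasShift E ℤ] [∀ n : ℤ, (shiftFunctor E n).Additive] [Pretriangulated E]
    [MonoidalCategory E] [∀ X : E, (tensorRight X).CommShift ℤ]
    [∀ X : E, (tensorRight X).IsTriangulated] {S : Set E} (hS : IsTriangulatedSub S)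
    (hideal : ∀ s ∈ S, ∀ t : E, s ⊗ t ∈ S)
    {T₀ : Triangle E} (hT₀ : T₀ ∈ distTriang E) (h₂ : T₀.obj₂ = 𝟙_ E) (hΓ : T₀.obj₁ ∈ S)
    (hloc : ∀ t : E, ∀ s ∈ S, ∀ f : s ⟶ T₀.obj₃ ⊗ t, f = 0) (t : E) :
    (∀ s ∈ S, ∀ f : s ⟶ t, f = 0) ↔ IsZero (T₀.obj₁ ⊗ t) := by
  have hT := (tensorRight t).map_distinguished T₀ hT₀
  let e : T₀.obj₂ ⊗ t ≅ t := whiskerRightIso (eqToIso h₂) t ≪≫ λ_ t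
  constructor
  · intro ht
    exact isZero_obj₁_of_hom_eq_zero _ hT
      (mem_rightOrth_of_iso e.symm ht _ (hideal _ hΓ t) _)
      (hloc t _ (hS.shift_one_mem (hideal _ hΓ t)))
  · intro hz
    have : IsIso ((tensorRight t).mapTriangle.obj T₀).mor₂ :=
      (Triangle.isZero₁_iff_isIso₂ _ hT).1 hz
    exact mem_rightOrth_of_iso
      ((asIso ((tensorRight t).mapTriangle.obj T₀).mor₂).symm ≪≫ e) (hloc t)

/-- Let `S` be a Bousfield tensor ideal with idempotent triangle
`Γ(1) → 1 → L(1) → Γ(1)[1]`, and suppose `L(1) ⊗ t ∈ S^⊥` for every `t`. Then `S^⊥` is a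
tensor ideal and `S` is smashing, i.e. `S^⊥` is closed under small coproducts. -/
theorem smashing_of_unit_local (S : Set C) (hS : IsBousfield S)
    (hideal : ∀ s ∈ S, ∀ t : C, s ⊗ t ∈ S)
    (T₀ : Triangle C) (hT₀ : T₀ ∈ distTriang C) (h₂ : T₀.obj₂ = 𝟙_ C)
    (hΓ : T₀.obj₁ ∈ S) (hL : T₀.obj₃ ∈ rightOrth S)
    (hloc : ∀ t : C, T₀.obj₃ ⊗ t ∈ rightOrth S) :
    (IsTriangulatedSub (rightOrth S) ∧
        ∀ s ∈ rightOrth S, ∀ t : C, s ⊗ t ∈ rightOrth S) ∧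
      ∀ {ι : Type v} (x : ι → C), (∀ i, x i ∈ rightOrth S) → (∐ x) ∈ rightOrth S := by
  have key : ∀ t : C, t ∈ rightOrth S ↔ IsZero (T₀.obj₁ ⊗ t) :=
    mem_rightOrth_iff_isZero_tensor hS.1 hideal hT₀ h₂ hΓ hloc
  have hdist (T : Triangle C) (hT : T ∈ distTriang C) :=
    (tensorLeft T₀.obj₁).map_distinguished T hT
  refine ⟨⟨⟨fun _ _ _ => (isZero_zero C).eq_of_tgt _ _,
    fun _ _ e hX => mem_rightOrth_of_iso e hX, ?_, ?_, ?_⟩, ?_⟩, ?_⟩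
  · intro T hT h h'
    rw [key] at h h' ⊢
    exact Triangle.isZero₃_of_isZero₁₂ _ (hdist T hT) h h'
  · intro T hT h h'
    rw [key] at h h' ⊢
    exact Triangle.isZero₂_of_isZero₁₃ _ (hdist T hT) h h'
  · intro T hT h h'
    rw [key] at h h' ⊢
    exact Triangle.isZero₁_of_isZero₂₃ _ (hdist T hT) h h'
  · intro s hs t
    rw [key] at hs ⊢
    exact ((tensorRight t).map_isZero hs).of_iso (α_ _ _ _).symm
  · intro ι x hx
    rw [key, IsZero.iff_id_eq_zero]
    refine (isColimitOfPreserves (tensorLeft T₀.obj₁)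
      (coproductIsCoproduct x)).hom_ext fun ⟨i⟩ => ?_
    exact ((key _).1 (hx i)).eq_of_src _ _

end Paper
end

section
/- Let X be a spectral topological space. A subset E ⊆ X is *-open (i.e., E is stable under specialization and is a union of constructible subsets) if and only if E is a union of closed constructible subsets, equivalently a union of closed subsets each of whose complement is a quasi-compact open subset. (Such subsets are called Thomason subsets.) -/
open TopologicalSpace Set

universe u u₂

namespace Paper

variable {X : Type u} [TopologicalSpace X]

/-- A subset is retrocompact if its intersection with every quasi-compact open subset is
quasi-compact. -/
def IsRetrocompact (s : Set X) : Prop :=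
  ∀ U : Set X, IsOpen U → IsCompact U → IsCompact (s ∩ U)

/-- A subset is constructible if it is a finite union of sets `U \ V` with `U`, `V`
retrocompact open subsets. -/
def IsConstructible (E : Set X) : Prop :=
  ∃ S : Finset (Set X × Set X),
    (∀ p ∈ S, IsOpen p.1 ∧ IsRetrocompact p.1 ∧ IsOpen p.2 ∧ IsRetrocompact p.2) ∧
    E = ⋃ p ∈ S, p.1 \ p.2

/-- A subset is ind-constructible (C-open) if it is a union of constructible subsets. -/
def IsUnionConstructible (E : Set X) : Prop :=
  ∃ S : Set (Set X), (∀ s ∈ S, IsConstructible s) ∧ E = ⋃₀ S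

/-- A subset is pro-constructible (C-closed) if it is an intersection of constructible
subsets. -/
def IsInterConstructible (E : Set X) : Prop :=
  ∃ S : Set (Set X), (∀ s ∈ S, IsConstructible s) ∧ E = ⋂₀ S

/-- A Thomason (`*`-open) subset: stable under specialization and a union of constructible
subsets. -/
def IsThomason (E : Set X) : Prop :=
  StableUnderSpecialization E ∧ IsUnionConstructible E

/-- A spectral space: quasi-compact, sober, and the quasi-compact open subsets form a basis
of the topology which is closed under finite intersections. -/
class SpectralSpace (X : Type u) [TopologicalSpace X] : Prop where
  compact : CompactSpace X
  quasiSober : QuasiSober X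
  t0 : T0Space X
  basis_qc_opens : IsTopologicalBasis {U : Set X | IsOpen U ∧ IsCompact U}
  inter_qc : ∀ U V : Set X, IsOpen U → IsCompact U → IsOpen V → IsCompact V →
    IsCompact (U ∩ V)

section Helpers

open scoped Topology

variable [SpectralSpace X]

lemma isOpen_constructibleTopology_of_isOpen {U : Set X} (hU : IsOpen U) :
    IsOpen[constructibleTopology X] U := by
  obtain ⟨S, hS, rfl⟩ := SpectralSpace.basis_qc_opens.open_eq_sUnion hU
  exact @isOpen_sUnion _ (constructibleTopology X) _ fun s hs =>
    (hS hs).2.isOpen_constructibleTopology_of_isOpen (hS hs).1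

lemma IsRetrocompact.isCompact {U : Set X} (hU : IsRetrocompact U) : IsCompact U := by
  have := SpectralSpace.compact (X := X)
  simpa using hU univ isOpen_univ isCompact_univ

lemma isRetrocompact_of_isCompact {U : Set X} (hU : IsOpen U) (hc : IsCompact U) :
    IsRetrocompact U :=
  fun V hV hVc => SpectralSpace.inter_qc U V hU hc hV hVc

lemma IsConstructible.isOpen_constructibleTopology {s : Set X} (hs : IsConstructible s) :
    IsOpen[constructibleTopology X] s := by
  obtain ⟨S, hS, rfl⟩ := hs
  refine @isOpen_biUnion _ _ (constructibleTopology X) _ _ fun p hp => ?_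
  obtain ⟨h₁, -, h₂, hc⟩ := hS p hp
  rw [sdiff_eq]
  refine @IsOpen.inter _ (constructibleTopology X) _ _
    (isOpen_constructibleTopology_of_isOpen h₁) ?_
  exact IsCompact.isOpen_constructibleTopology_of_isClosed
    (by simpa using hc.isCompact) h₂.isClosed_compl

lemma IsUnionConstructible.isOpen_constructibleTopology {s : Set X}
    (hs : IsUnionConstructible s) : IsOpen[constructibleTopology X] s := by
  obtain ⟨S, hS, rfl⟩ := hs
  exact @isOpen_sUnion _ (constructibleTopology X) _ fun s hs =>
    (hS s hs).isOpen_constructibleTopology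

lemma compactSpace_constructibleTopology : @CompactSpace X (constructibleTopology X) := by
  have := SpectralSpace.compact (X := X)
  have := SpectralSpace.quasiSober (X := X)
  have : QuasiSeparatedSpace X := ⟨SpectralSpace.inter_qc⟩
  have : PrespectralSpace X := ⟨SpectralSpace.basis_qc_opens⟩
  exact @Function.Surjective.compactSpace (WithConstructibleTopology X) X _
    (constructibleTopology X) _ (WithTopology.continuous_ofTopology _) inferInstance
    (WithTopology.ofTopology_surjective _)

lemma isCompact_compl_of_isOpen_constructibleTopology {s : Set X}
    (hs : IsOpen[constructibleTopology X] s) : IsCompact sᶜ := by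
  have hc : @IsCompact X (constructibleTopology X) sᶜ := by
    have := compactSpace_constructibleTopology (X := X)
    exact @IsClosed.isCompact _ (constructibleTopology X) _ this
      (@IsOpen.isClosed_compl _ (constructibleTopology X) _ hs)
  have := @IsCompact.image X X (constructibleTopology X) _ _ id hc
    (continuous_def.2 fun U hU => isOpen_constructibleTopology_of_isOpen hU)
  simpa using this

lemma isConstructible_of_isCompact_compl {s : Set X} (ho : IsOpen sᶜ) (hc : IsCompact sᶜ) :
    IsConstructible s :=
  ⟨{(univ, sᶜ)}, by
    simpa using ⟨fun U _ hU => by simpa using hU, isOpen_compl_iff.1 ho,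
      isRetrocompact_of_isCompact ho hc⟩, by simp⟩

lemma exists_isClosed_isCompact_compl_subset {E : Set X} (hE : StableUnderSpecialization E)
    (ho : IsOpen[constructibleTopology X] E) {x : X} (hx : x ∈ E) :
    ∃ s ⊆ E, x ∈ s ∧ IsClosed s ∧ IsCompact sᶜ := by
  let ι := {V : Set X // (IsOpen V ∧ IsCompact V) ∧ x ∉ V}
  have hcomp : IsCompact Eᶜ := isCompact_compl_of_isOpen_constructibleTopology ho
  obtain ⟨t, ht⟩ := hcomp.elim_finite_subcover (fun V : ι => V.1) (fun V => V.2.1.1) (by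
    intro y hy
    have hxy : ¬ x ⤳ y := fun h => hy (hE h hx)
    obtain ⟨U, hU, hyU, hxU⟩ := not_specializes_iff_exists_open.1 hxy
    obtain ⟨V, hV, hyV, hVU⟩ :=
      SpectralSpace.basis_qc_opens.exists_subset_of_mem_open hyU hU
    exact mem_iUnion.2 ⟨⟨V, hV, fun h => hxU (hVU h)⟩, hyV⟩)
  refine ⟨(⋃ V ∈ t, V.1)ᶜ, compl_subset_comm.1 ht, ?_, ?_, ?_⟩
  · simp only [mem_compl_iff, mem_iUnion, not_exists]
    exact fun V _ => V.2.2
  · exact (isOpen_biUnion fun V _ => V.2.1.1).isClosed_compl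
  · rw [compl_compl]
    exact t.isCompact_biUnion fun V _ => V.2.1.2

end Helpers

/-- In a spectral space, a subset is `*`-open (Thomason) iff it is a union
of closed constructible subsets, iff it is a union of closed subsets with quasi-compact open
complement. -/
theorem thomason_iff_union_closed_constructible [SpectralSpace X] (E : Set X) :
    ((StableUnderSpecialization E ∧ IsUnionConstructible E) ↔
      ∃ S : Set (Set X), (∀ s ∈ S, IsClosed s ∧ IsConstructible s) ∧ E = ⋃₀ S) ∧
    ((∃ S : Set (Set X), (∀ s ∈ S, IsClosed s ∧ IsConstructible s) ∧ E = ⋃₀ S) ↔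
      ∃ S : Set (Set X), (∀ s ∈ S, IsClosed s ∧ IsOpen sᶜ ∧ IsCompact sᶜ) ∧ E = ⋃₀ S) := by
  have hiff (s : Set X) : (IsClosed s ∧ IsConstructible s) ↔
      (IsClosed s ∧ IsOpen sᶜ ∧ IsCompact sᶜ) := by
    refine and_congr_right fun hs => ⟨fun h => ⟨hs.isOpen_compl, ?_⟩, fun h => ?_⟩
    · exact isCompact_compl_of_isOpen_constructibleTopology h.isOpen_constructibleTopology
    · exact isConstructible_of_isCompact_compl h.1 h.2
  refine ⟨⟨fun ⟨hE, hU⟩ => ?_, ?_⟩, by simp only [hiff]⟩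
  · refine ⟨{s | s ⊆ E ∧ IsClosed s ∧ IsConstructible s}, fun s hs => hs.2,
      Subset.antisymm (fun x hx => ?_) (sUnion_subset fun s hs => hs.1)⟩
    obtain ⟨s, hsE, hxs, hs, hc⟩ :=
      exists_isClosed_isCompact_compl_subset hE hU.isOpen_constructibleTopology hx
    exact ⟨s, ⟨hsE, hs, isConstructible_of_isCompact_compl hs.isOpen_compl hc⟩, hxs⟩
  · rintro ⟨S, hS, rfl⟩
    exact ⟨stableUnderSpecialization_sUnion S fun s hs => (hS s hs).1.stableUnderSpecialization,
      S, fun s hs => (hS s hs).2, rfl⟩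

end Paper
end

section
/- Let f : X' → X be a continuous surjection of spectral spaces which is S-submersive (a subset E ⊆ X is stable under generization if and only if f⁻¹(E) is stable under generization) and C-submersive (a subset E ⊆ X is a union of constructible subsets if and only if f⁻¹(E) is a union of constructible subsets). Let X'' = X' ×_X X' be the topological fibre product, with projections pr₁, pr₂ : X'' → X'. Then the map E ↦ f⁻¹(E) is a bijection from the set of Thomason subsets of X onto the set of Thomason subsets E' of X' satisfying pr₁⁻¹(E') = pr₂⁻¹(E'); i.e., the sequence Tho(X) → Tho(X') ⇉ Tho(X'') is an equalizer of sets. -/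
open TopologicalSpace Set

universe u u₂

namespace Paper

variable {X : Type u} [TopologicalSpace X]

/-- For an S- and C-submersive continuous surjection `f : X' → X` of
spectral spaces, `E ↦ f ⁻¹' E` is a bijection from the Thomason subsets of `X` onto the
Thomason subsets of `X'` whose two preimages in the fibre product `X' ×_X X'` agree. -/
theorem thomason_equalizer {X' : Type u₂} [TopologicalSpace X']
    [SpectralSpace X] [SpectralSpace X'] (f : X' → X) (hcont : Continuous f)
    (hsurj : Function.Surjective f)
    (hS : ∀ E : Set X, StableUnderGeneralization E ↔ StableUnderGeneralization (f ⁻¹' E))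
    (hC : ∀ E : Set X, IsUnionConstructible E ↔ IsUnionConstructible (f ⁻¹' E)) :
    Set.BijOn (fun E : Set X => f ⁻¹' E) {E : Set X | IsThomason E}
      {E' : Set X' | IsThomason E' ∧
        (fun p : {p : X' × X' // f p.1 = f p.2} => p.1.1) ⁻¹' E' =
        (fun p : {p : X' × X' // f p.1 = f p.2} => p.1.2) ⁻¹' E'} := by
  have hT : ∀ E : Set X, IsThomason E ↔ IsThomason (f ⁻¹' E) := fun E =>
    and_congr
      (by rw [← stableUnderGeneralization_compl_iff, hS, preimage_compl,
        stableUnderGeneralization_compl_iff])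
      (hC E)
  refine ⟨fun E hE => ⟨(hT E).1 hE, ?_⟩, fun E _ F _ h => hsurj.preimage_injective h, ?_⟩
  · ext p
    exact iff_of_eq (congrArg (· ∈ E) p.2)
  · rintro E' ⟨hE', heq⟩
    have hsat : f ⁻¹' (f '' E') = E' := by
      refine Subset.antisymm ?_ (subset_preimage_image f E')
      rintro x ⟨y, hy, hyx⟩
      exact (Set.ext_iff.1 heq ⟨(y, x), hyx⟩).1 hy
    exact ⟨f '' E', (hT _).2 (hsat.symm ▸ hE'), hsat⟩

end Paper
end
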